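/- Let R be a field of characteristic p ≥ 0 and σ ∈ Σ_n a permutation of cycle type (λ_1, ..., λ_k). Then the set of elementary divisors of the permutation matrix c_σ (i.e., of xI_n − c_σ over R[x]) is { g(x)^{p^{ν_p(λ_i)}} : 1 ≤ i ≤ k, g(x) an irreducible factor of x^{λ_i} − 1 in R[x] }, where ν_p(λ) denotes the p-adic valuation of λ (and p^{ν_p(λ)} := 1 when p = 0). -/

import Mathlib

set_option synthInstance.maxHeartbeats 400000

/-- `q` is an elementary divisor of the square matrix `c` over a field `R`: `q = p^k` for a
monic irreducible `p ∈ R[x]` and `k ≥ 1`, and `R[x]/(q)` is (isomorphic to) a direct summand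
of `R^n` regarded as an `R[x]`-module via `c` (equivalently, `q` appears in the primary
decomposition of this module; by Krull–Schmidt for f.g. torsion modules over the PID `R[x]`
these two descriptions agree). -/
def IsElemDiv (R : Type*) [Field R] {n : ℕ} (c : Matrix (Fin n) (Fin n) R)
    (q : Polynomial R) : Prop :=
  ∃ p : Polynomial R, p.Monic ∧ Irreducible p ∧ ∃ k : ℕ, 1 ≤ k ∧ q = p ^ k ∧
    ∃ N P : Submodule (Polynomial R) (Module.AEval' (Matrix.mulVecLin c)),
      IsCompl N P ∧ Nonempty (N ≃ₗ[Polynomial R] (Polynomial R ⧸ Ideal.span {q}))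

/-- If `g` and `u` are coprime, the `g`-torsion of `A ⧸ (g ^ v * u)` does not
distinguish multiples of `g ^ k` from multiples of `g ^ (k + 1)` when `v ≠ k + 1`. -/
theorem exists_eq_pow_smul_of_smul_pow_smul_eq_zero {A : Type*} [CommRing A] [IsDomain A]
    {g u : A} {v k : ℕ} (hg : g ≠ 0) (hgu : IsCoprime g u) (hvk : v ≠ k + 1)
    (b : A ⧸ Ideal.span {g ^ v * u}) (hb : g • g ^ k • b = 0) :
    ∃ z : A ⧸ Ideal.span {g ^ v * u}, g ^ k • b = g ^ (k + 1) • z := by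
  obtain ⟨a, rfl⟩ := Ideal.Quotient.mk_surjective b
  have smul_mk : ∀ c d : A, c • Ideal.Quotient.mk (Ideal.span {g ^ v * u}) d =
      Ideal.Quotient.mk _ (c * d) := fun _ _ ↦ rfl
  rw [smul_mk, smul_mk, Ideal.Quotient.eq_zero_iff_mem, Ideal.mem_span_singleton,
    ← mul_assoc, ← pow_succ'] at hb
  rcases Nat.lt_or_ge v (k + 1) with h | h
  · refine ⟨0, ?_⟩
    rw [smul_zero, smul_mk, Ideal.Quotient.eq_zero_iff_mem, Ideal.mem_span_singleton]
    have hu : u ∣ a := hgu.symm.pow_right.dvd_of_dvd_mul_left ((Dvd.intro_left _ rfl).trans hb)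
    exact mul_dvd_mul (pow_dvd_pow g (by omega)) hu
  · obtain ⟨d, rfl⟩ := Nat.exists_eq_add_of_lt (lt_of_le_of_ne h (Ne.symm hvk))
    have hga : g ∣ a := by
      rw [show k + 1 + d + 1 = (k + 1) + (d + 1) by omega, pow_add, mul_assoc,
        mul_dvd_mul_iff_left (pow_ne_zero _ hg), pow_succ', mul_assoc] at hb
      exact dvd_of_mul_right_dvd hb
    obtain ⟨c, rfl⟩ := hga
    exact ⟨Ideal.Quotient.mk _ c, by rw [smul_mk, smul_mk]; congr 1; ring⟩

/-- A split injection exhibits its source as a direct summand. -/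
theorem LinearMap.exists_isCompl_of_comp_eq_id {A M Q : Type*} [Ring A] [AddCommGroup M]
    [Module A M] [AddCommGroup Q] [Module A Q] (s : Q →ₗ[A] M) (r : M →ₗ[A] Q)
    (h : r ∘ₗ s = LinearMap.id) :
    ∃ N P : Submodule A M, IsCompl N P ∧ Nonempty (N ≃ₗ[A] Q) := by
  have hrs : ∀ x, r (s x) = x := LinearMap.congr_fun h
  refine ⟨LinearMap.range s, LinearMap.ker (s.rangeRestrict ∘ₗ r), LinearMap.isCompl_of_proj ?_,
    ⟨(LinearEquiv.ofInjective s (Function.LeftInverse.injective hrs)).symm⟩⟩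
  rintro ⟨_, x, rfl⟩
  ext
  simp [hrs]

/-- `A ⧸ (q)` is a retract of `A ⧸ (q * u)` if `q` and `u` are coprime. -/
theorem exists_retract_quotient_span_mul {A : Type*} [CommRing A] {q u : A} (h : IsCoprime q u) :
    ∃ (s : (A ⧸ Ideal.span {q}) →ₗ[A] (A ⧸ Ideal.span {q * u}))
      (r : (A ⧸ Ideal.span {q * u}) →ₗ[A] (A ⧸ Ideal.span {q})), r ∘ₗ s = LinearMap.id := by
  obtain ⟨a, b, hab⟩ := h
  refine ⟨Submodule.liftQ (Ideal.span {q})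
      (LinearMap.toSpanSingleton A (A ⧸ Ideal.span {q * u}) (Ideal.Quotient.mk _ (b * u))) ?_,
    Submodule.factor (Ideal.span_singleton_le_span_singleton.2 (dvd_mul_right q u)), ?_⟩
  · rw [Ideal.span_le, Set.singleton_subset_iff, SetLike.mem_coe, LinearMap.mem_ker,
      LinearMap.toSpanSingleton_apply]
    change Ideal.Quotient.mk _ (q * (b * u)) = 0
    rw [Ideal.Quotient.eq_zero_iff_mem, Ideal.mem_span_singleton]
    exact ⟨b, by ring⟩
  · refine Submodule.linearMap_qext _ (LinearMap.ext_ring ?_)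
    change Ideal.Quotient.mk (Ideal.span {q}) (1 * (b * u)) = Ideal.Quotient.mk _ 1
    rw [Ideal.Quotient.eq, Ideal.mem_span_singleton]
    exact ⟨-a, by linear_combination hab⟩

open Polynomial in
/-- The multiplicity of an irreducible factor of `X ^ m - 1`. -/
theorem exists_X_pow_sub_one_eq_pow_mul {R : Type*} [Field R] {m : ℕ} (hm : m ≠ 0) {g : R[X]}
    (hg : Irreducible g) :
    ∃ (v : ℕ) (u : R[X]), (X : R[X]) ^ m - 1 = g ^ v * u ∧ IsCoprime g u ∧
      (v = 0 ∨ g ∣ X ^ m - 1) ∧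
      (g ∣ X ^ m - 1 → v = ringChar R ^ padicValNat (ringChar R) m) := by
  by_cases hdvd : g ∣ X ^ m - 1
  swap
  · exact ⟨0, _, by rw [pow_zero, one_mul], (hg.coprime_iff_not_dvd).2 hdvd, Or.inl rfl,
      fun h ↦ absurd h hdvd⟩
  obtain ⟨l, hl, hlm⟩ : ∃ l : ℕ, (l : R) ≠ 0 ∧ (X : R[X]) ^ m - 1 =
      (X ^ l - 1) ^ ringChar R ^ padicValNat (ringChar R) m := by
    rcases CharP.char_is_prime_or_zero R (ringChar R) with hp | hp
    · have : Fact (ringChar R).Prime := ⟨hp⟩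
      have : CharP R[X] (ringChar R) := inferInstance
      obtain ⟨l, hl⟩ := pow_padicValNat_dvd (p := ringChar R) (n := m)
      refine ⟨l, fun h ↦ ?_, ?_⟩
      · rw [CharP.cast_eq_zero_iff R (ringChar R)] at h
        refine pow_succ_padicValNat_not_dvd (p := ringChar R) hm ?_
        rw [pow_succ]
        conv_rhs => rw [hl]
        exact mul_dvd_mul_left _ h
      · rw [sub_pow_char_pow, one_pow, ← pow_mul, mul_comm l, ← hl]
    · have : CharP R 0 := hp ▸ ringChar.charP R
      have : CharZero R := CharP.charP_to_charZero R
      exact ⟨m, Nat.cast_ne_zero.2 hm, by simp⟩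
  rw [hlm] at hdvd ⊢
  obtain ⟨u, hu⟩ := hg.prime.dvd_of_dvd_pow hdvd
  refine ⟨_, u ^ ringChar R ^ padicValNat (ringChar R) m, by rw [hu, mul_pow], ?_, Or.inr hdvd,
    fun _ ↦ rfl⟩
  have hsep : (X ^ l - 1 : R[X]).Separable := X_pow_sub_one_separable_iff.2 hl
  rw [hu] at hsep
  exact hsep.isCoprime.pow_right

open Function in
theorem Equiv.Perm.mem_cycleType_add_replicate_iff {α : Type*} [Fintype α] [DecidableEq α]
    (σ : Equiv.Perm α) (m : ℕ) :
    m ∈ σ.cycleType + Multiset.replicate (Fintype.card α - σ.cycleType.sum) 1 ↔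
      ∃ a, minimalPeriod σ a = m := by
  have key : ∀ a, σ a ≠ a → minimalPeriod σ a = (σ.cycleOf a).support.card := by
    intro a ha
    have hc := σ.isCycle_cycleOf ha
    rw [← hc.orderOf]
    refine Nat.dvd_right_iff_eq.1 fun d ↦ ?_
    rw [← isPeriodicPt_iff_minimalPeriod_dvd, orderOf_dvd_iff_pow_eq_one,
      hc.pow_eq_one_iff' (x := a) (by rwa [Equiv.Perm.cycleOf_apply_self]),
      Equiv.Perm.cycleOf_pow_apply_self, IsPeriodicPt, IsFixedPt, Equiv.Perm.iterate_eq_pow]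
  rw [Multiset.mem_add, Equiv.Perm.sum_cycleType, Multiset.mem_replicate,
    Equiv.Perm.cycleType_def, Multiset.mem_map]
  constructor
  · rintro (⟨c, hc, rfl⟩ | ⟨h0, rfl⟩)
    · rw [Finset.mem_val] at hc
      obtain ⟨a, ha⟩ := (Equiv.Perm.mem_cycleFactorsFinset_iff.1 hc).1.nonempty_support
      have hca := Equiv.Perm.cycle_is_cycleOf ha hc
      refine ⟨a, ?_⟩
      rw [key, ← hca, comp_apply]
      exact Equiv.Perm.mem_support.1 (Equiv.Perm.mem_cycleFactorsFinset_support_le hc ha)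
    · have : σ.support ≠ Finset.univ := by
        intro h
        rw [h, Finset.card_univ, Nat.sub_self] at h0
        exact h0 rfl
      obtain ⟨a, ha⟩ := not_forall.1 (mt Finset.eq_univ_iff_forall.2 this)
      exact ⟨a, minimalPeriod_eq_one_iff_isFixedPt.2 (Equiv.Perm.notMem_support.1 ha)⟩
  · rintro ⟨a, rfl⟩
    by_cases ha : σ a = a
    · refine Or.inr ⟨?_, minimalPeriod_eq_one_iff_isFixedPt.2 ha⟩
      have : σ.support.card < Fintype.card α :=
        Finset.card_lt_univ_of_notMem (Equiv.Perm.notMem_support.2 ha)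
      omega
    · exact Or.inl ⟨σ.cycleOf a, Equiv.Perm.cycleOf_mem_cycleFactorsFinset_iff.2
        (Equiv.Perm.mem_support.2 ha), (key a ha).symm⟩

section PermModule

open Polynomial Function

variable {R : Type*} [Field R] {n : ℕ} (σ : Equiv.Perm (Fin n))

/-- The standard basis vector at `a` in the `R[X]`-module given by a permutation matrix. -/
noncomputable def permBasisVec (a : Fin n) : Module.AEval' (σ.permMatrix R).mulVecLin :=
  Module.AEval'.of _ (Pi.single a 1)

theorem X_pow_smul_permBasisVec (a : Fin n) (i : ℕ) :
    (X : R[X]) ^ i • permBasisVec (R := R) σ a = permBasisVec σ ((⇑σ⁻¹)^[i] a) := by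
  induction i with
  | zero => simp
  | succ i ih =>
    rw [pow_succ', mul_smul, ih, iterate_succ_apply', permBasisVec, permBasisVec,
      Module.AEval'.X_smul_of]
    congr 1
    ext j
    simp [Pi.single_apply, Equiv.eq_symm_apply]

/-- The `R[X]`-linear map from the cyclic module attached to the cycle of `a` to `R ^ n`. -/
noncomputable def cycleInclusion (a : Fin n) :
    (R[X] ⧸ Ideal.span {(X : R[X]) ^ minimalPeriod (⇑σ⁻¹) a - 1}) →ₗ[R[X]]
      Module.AEval' (σ.permMatrix R).mulVecLin :=
  Submodule.liftQ _ (LinearMap.toSpanSingleton R[X] _ (permBasisVec σ a)) <| by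
    rw [Ideal.span_le, Set.singleton_subset_iff, SetLike.mem_coe, LinearMap.mem_ker,
      LinearMap.toSpanSingleton_apply, sub_smul, one_smul, X_pow_smul_permBasisVec,
      iterate_minimalPeriod, sub_self]

theorem cycleInclusion_one (a : Fin n) :
    cycleInclusion (R := R) σ a (Ideal.Quotient.mk _ 1) = permBasisVec σ a :=
  one_smul R[X] _

/-- The `R[X]`-linear map from `R ^ n` onto the cyclic module attached to the cycle of `a`. -/
noncomputable def cycleProjection (a : Fin n) :
    Module.AEval' (σ.permMatrix R).mulVecLin →ₗ[R[X]]
      (R[X] ⧸ Ideal.span {(X : R[X]) ^ minimalPeriod (⇑σ⁻¹) a - 1}) :=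
  LinearMap.ofAEval _
    (∑ i ∈ Finset.range (minimalPeriod (⇑σ⁻¹) a),
      (LinearMap.toSpanSingleton R _
        (Ideal.Quotient.mk (Ideal.span {(X : R[X]) ^ minimalPeriod (⇑σ⁻¹) a - 1}) (X ^ i))) ∘ₗ
      (LinearMap.proj ((⇑σ⁻¹)^[i] a) : (Fin n → R) →ₗ[R] R)) <| by
    intro v
    set l := minimalPeriod (⇑σ⁻¹) a with hl
    have hX : Ideal.Quotient.mk (Ideal.span {(X : R[X]) ^ l - 1}) (X ^ l) =
        Ideal.Quotient.mk _ (X ^ 0) := by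
      rw [Ideal.Quotient.eq, pow_zero]
      exact Ideal.mem_span_singleton_self _
    have hsmul : ∀ i, (X : R[X]) • Ideal.Quotient.mk (Ideal.span {(X : R[X]) ^ l - 1}) (X ^ i) =
        Ideal.Quotient.mk _ (X ^ (i + 1)) := fun i ↦ by rw [pow_succ']; rfl
    simp only [LinearMap.sum_apply, LinearMap.comp_apply, LinearMap.proj_apply,
      LinearMap.toSpanSingleton_apply, Module.End.smul_def, Matrix.mulVecLin_apply,
      Matrix.permMatrix_mulVec, comp_apply, Finset.smul_sum]
    simp only [smul_comm (X : R[X]), hsmul]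
    set F : ℕ → R[X] ⧸ Ideal.span {(X : R[X]) ^ l - 1} := fun i ↦
      v (σ ((⇑σ⁻¹)^[i] a)) • Ideal.Quotient.mk _ (X ^ i) with hF
    have hF1 : ∀ i, v ((⇑σ⁻¹)^[i] a) • Ideal.Quotient.mk
        (Ideal.span {(X : R[X]) ^ l - 1}) (X ^ (i + 1)) = F (i + 1) := by
      intro i
      rw [hF]
      simp only [iterate_succ_apply']
      rw [show σ (σ⁻¹ ((⇑σ⁻¹)^[i] a)) = _ from σ.apply_symm_apply _]
    have hFl : F l = F 0 := by
      have hla : (⇑σ⁻¹)^[l] a = a := iterate_minimalPeriod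
      simp only [hF, hX, hla, iterate_zero, id]
    simp only [hF1]
    change ∑ i ∈ Finset.range l, F i = _
    have := Finset.sum_range_succ F l
    rw [Finset.sum_range_succ', hFl] at this
    exact (add_right_cancel this).symm

theorem cycleProjection_permBasisVec (a b : Fin n) :
    cycleProjection (R := R) σ a (permBasisVec σ b) =
      ∑ i ∈ Finset.range (minimalPeriod (⇑σ⁻¹) a),
        (Pi.single b 1 : Fin n → R) ((⇑σ⁻¹)^[i] a) • Ideal.Quotient.mk _ (X ^ i) := by
  simp [cycleProjection, LinearMap.ofAEval, permBasisVec]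

theorem minimalPeriod_inv_pos (a : Fin n) : 0 < minimalPeriod (⇑σ⁻¹) a :=
  minimalPeriod_pos_of_mem_periodicPts (σ⁻¹.injective.mem_periodicPts a)

theorem cycleProjection_permBasisVec_self (a : Fin n) :
    cycleProjection (R := R) σ a (permBasisVec σ a) = Ideal.Quotient.mk _ 1 := by
  rw [cycleProjection_permBasisVec, Finset.sum_eq_single_of_mem 0
    (Finset.mem_range.2 (minimalPeriod_inv_pos σ a))]
  · simp
  · intro i hi hi0
    rw [Pi.single_eq_of_ne, zero_smul]
    exact fun h ↦ not_isPeriodicPt_of_pos_of_lt_minimalPeriod hi0 (Finset.mem_range.1 hi) h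

theorem cycleProjection_permBasisVec_of_not_sameCycle {a b : Fin n} (h : ¬ σ.SameCycle a b) :
    cycleProjection (R := R) σ a (permBasisVec σ b) = 0 := by
  rw [cycleProjection_permBasisVec]
  refine Finset.sum_eq_zero fun i _ ↦ ?_
  rw [Pi.single_eq_of_ne, zero_smul]
  rintro rfl
  refine h ?_
  rw [← Equiv.Perm.sameCycle_inv, Equiv.Perm.iterate_eq_pow]
  exact ⟨i, by simp⟩

theorem cycleProjection_comp_cycleInclusion (a : Fin n) :
    cycleProjection (R := R) σ a ∘ₗ cycleInclusion σ a = LinearMap.id := by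
  refine Submodule.linearMap_qext _ (LinearMap.ext_ring ?_)
  change cycleProjection (R := R) σ a (cycleInclusion σ a (Ideal.Quotient.mk _ 1)) =
    Ideal.Quotient.mk _ 1
  rw [cycleInclusion_one, cycleProjection_permBasisVec_self]

open Classical in
theorem sum_cycleInclusion_cycleProjection
    (m : Module.AEval' (σ.permMatrix R).mulVecLin) :
    ∑ c : Quotient (Equiv.Perm.SameCycle.setoid σ),
      cycleInclusion σ c.out (cycleProjection σ c.out m) = m := by
  suffices h : (∑ c : Quotient (Equiv.Perm.SameCycle.setoid σ),
      cycleInclusion (R := R) σ c.out ∘ₗ cycleProjection σ c.out).restrictScalars R ∘ₗ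
        (Module.AEval'.of (σ.permMatrix R).mulVecLin).toLinearMap =
      (Module.AEval'.of (σ.permMatrix R).mulVecLin).toLinearMap by
    obtain ⟨v, rfl⟩ := (Module.AEval'.of (σ.permMatrix R).mulVecLin).surjective m
    simpa using LinearMap.congr_fun h v
  refine LinearMap.pi_ext' fun b ↦ LinearMap.ext_ring ?_
  change (∑ c : Quotient (Equiv.Perm.SameCycle.setoid σ),
    cycleInclusion (R := R) σ c.out ∘ₗ cycleProjection σ c.out) (permBasisVec σ b) =
      permBasisVec σ b
  have hb : σ.SameCycle (Quotient.mk (Equiv.Perm.SameCycle.setoid σ) b).out b :=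
    Quotient.mk_out (s := Equiv.Perm.SameCycle.setoid σ) b
  obtain ⟨i, hi⟩ := (Equiv.Perm.sameCycle_inv.2 hb).exists_nat_pow_eq
  rw [← Equiv.Perm.iterate_eq_pow] at hi
  rw [← congrArg (permBasisVec σ) hi, ← X_pow_smul_permBasisVec, map_smul, LinearMap.sum_apply,
    Finset.sum_eq_single_of_mem (Quotient.mk (Equiv.Perm.SameCycle.setoid σ) b)
      (Finset.mem_univ _)]
  · rw [LinearMap.comp_apply, cycleProjection_permBasisVec_self, cycleInclusion_one]
  · intro c _ hc
    rw [LinearMap.comp_apply, cycleProjection_permBasisVec_of_not_sameCycle, map_zero]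
    intro h
    refine hc ?_
    rw [← Quotient.out_eq c]
    exact Quotient.sound (h.trans hb)

end PermModule

/-- Let `R` be a field of characteristic `p ≥ 0` and `σ` a permutation of
`{1,...,n}` with (full) cycle type `(λ_1, ..., λ_k)` (Mathlib's `cycleType` together with one
`1` for each fixed point). Then the set of elementary divisors of the permutation matrix
`c_σ` is `{ g^(p^(ν_p λ_i)) : i, g a (monic) irreducible factor of x^(λ_i) − 1 }`, with the
convention `p^(ν_p λ) = 1` when `p = 0` (in Lean, `0 ^ 0 = 1` and `padicValNat 0 _ = 0`). -/
theorem stmt14 (R : Type*) [Field R] (n : ℕ) (σ : Equiv.Perm (Fin n)) (q : Polynomial R) :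
    IsElemDiv R (σ.permMatrix R) q ↔
      ∃ lam ∈ σ.cycleType + Multiset.replicate (n - σ.cycleType.sum) 1,
        ∃ g : Polynomial R, g.Monic ∧ Irreducible g ∧
          g ∣ ((Polynomial.X : Polynomial R) ^ lam - 1) ∧
          q = g ^ (ringChar R ^ padicValNat (ringChar R) lam) := by
  have hlam : ∀ m, m ∈ σ.cycleType + Multiset.replicate (n - σ.cycleType.sum) 1 ↔
      ∃ a, Function.minimalPeriod (⇑σ⁻¹) a = m := fun m ↦ by
    rw [← Equiv.Perm.mem_cycleType_add_replicate_iff, Equiv.Perm.cycleType_inv, Fintype.card_fin]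
  constructor
  · rintro ⟨g, hgm, hg, k, hk, rfl, N, P, hNP, ⟨e⟩⟩
    obtain ⟨k, rfl⟩ := Nat.exists_eq_add_of_le' hk
    by_contra! hcon
    have key : ∀ a (b : Module.AEval' (σ.permMatrix R).mulVecLin), g • g ^ k • b = 0 →
        ∃ z, g ^ k • cycleProjection σ a b = g ^ (k + 1) • z := by
      intro a b hb
      have hb' : g • g ^ k • cycleProjection σ a b = 0 := by
        rw [← map_smul, ← map_smul, hb, map_zero]
      obtain ⟨v, u, hvu, hgu, hv, hv'⟩ := exists_X_pow_sub_one_eq_pow_mul (R := R)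
        (minimalPeriod_inv_pos σ a).ne' hg
      have hvk : v ≠ k + 1 := by
        rintro rfl
        have hdvd := hv.resolve_left (Nat.succ_ne_zero k)
        exact hcon _ ((hlam _).2 ⟨a, rfl⟩) g hgm hg hdvd (by rw [← hv' hdvd])
      generalize cycleProjection σ a b = y at hb' ⊢
      revert y
      rw [hvu]
      exact exists_eq_pow_smul_of_smul_pow_smul_eq_zero hg.ne_zero hgu hvk
    set x : N := e.symm (Ideal.Quotient.mk _ 1) with hx
    have hex : ∀ c : Polynomial R, e (c • x) = Ideal.Quotient.mk _ c := fun c ↦ by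
      rw [map_smul, hx, LinearEquiv.apply_symm_apply]
      exact congrArg (Ideal.Quotient.mk _) (mul_one c)
    have hx0 : g ^ (k + 1) • x = 0 := by
      rw [← e.map_eq_zero_iff, hex, Ideal.Quotient.eq_zero_iff_mem]
      exact Ideal.mem_span_singleton_self _
    have hx1 : g • g ^ k • (x : Module.AEval' (σ.permMatrix R).mulVecLin) = 0 := by
      rw [← mul_smul, ← pow_succ', ← Submodule.coe_smul, hx0, Submodule.coe_zero]
    choose z hz using fun a ↦ key a x hx1
    have hm : ∃ y : Module.AEval' (σ.permMatrix R).mulVecLin,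
        g ^ k • (x : Module.AEval' (σ.permMatrix R).mulVecLin) = g ^ (k + 1) • y := by
      classical
      refine ⟨∑ c : Quotient (Equiv.Perm.SameCycle.setoid σ), cycleInclusion σ c.out (z c.out), ?_⟩
      rw [Finset.smul_sum, ← sum_cycleInclusion_cycleProjection σ (g ^ k • _)]
      refine Finset.sum_congr rfl fun c _ ↦ ?_
      rw [map_smul, hz, map_smul]
    obtain ⟨y, hy⟩ := hm
    have hproj := congrArg (fun w ↦ e (N.projectionOnto P hNP w)) hy
    simp only [map_smul, Submodule.projectionOnto_apply_left] at hproj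
    rw [← map_smul, hex] at hproj
    have hzero : ∀ w : Polynomial R ⧸ Ideal.span {g ^ (k + 1)}, g ^ (k + 1) • w = 0 := by
      intro w
      obtain ⟨w, rfl⟩ := Ideal.Quotient.mk_surjective w
      change Ideal.Quotient.mk _ (g ^ (k + 1) * w) = 0
      rw [Ideal.Quotient.eq_zero_iff_mem, Ideal.mem_span_singleton]
      exact dvd_mul_right _ _
    rw [hzero, Ideal.Quotient.eq_zero_iff_mem, Ideal.mem_span_singleton,
      pow_dvd_pow_iff hg.ne_zero hg.not_isUnit] at hproj
    omega
  · rintro ⟨m, hm, g, hgm, hg, hdvd, rfl⟩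
    obtain ⟨a, rfl⟩ := (hlam m).1 hm
    obtain ⟨v, u, hvu, hgu, -, hv⟩ := exists_X_pow_sub_one_eq_pow_mul (R := R)
      (minimalPeriod_inv_pos σ a).ne' hg
    rw [← hv hdvd]
    have hv1 : 1 ≤ v := by
      by_contra! h0
      obtain rfl : v = 0 := by omega
      rw [hvu, pow_zero, one_mul] at hdvd
      exact hg.not_isUnit (hgu.isUnit_of_dvd' dvd_rfl hdvd)
    refine ⟨g, hgm, hg, v, hv1, rfl, ?_⟩
    obtain ⟨s, r, hrs⟩ := exists_retract_quotient_span_mul (hgu.pow_left (m := v))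
    have hir := cycleProjection_comp_cycleInclusion (R := R) σ a
    generalize cycleInclusion (R := R) σ a = i at hir
    generalize cycleProjection (R := R) σ a = j at hir
    revert i j
    rw [hvu]
    intro i j hir
    refine LinearMap.exists_isCompl_of_comp_eq_id (i ∘ₗ s) (r ∘ₗ j) ?_
    rw [LinearMap.comp_assoc, ← LinearMap.comp_assoc s i j, hir, LinearMap.id_comp, hrs]
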